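/- arXiv:1306.2012 — 2 statements merged into one kernel-verified Lean document; each statement's English description precedes it below -/
import Mathlib

section
/- Let r ≥ 3 be fixed. There exist constants C > 0 and δ > 0 depending only on r such that for every degree sequence k with sum M divisible by r, k_max ≥ 2 and k_max^3 ≤ δM, one has |Λ_r^+(k)| / |Λ_r(k)| = 1 + E with |E| ≤ C·k_max^3/M. -/
open scoped Classical BigOperators

/-- The set of points for the configuration model: cell `i` contains `k i` points. -/
abbrev Pts {n : ℕ} (k : Fin n → ℕ) : Type := (i : Fin n) × Fin (k i)

/-- `M`, the total degree. -/
def Mtot {n : ℕ} (k : Fin n → ℕ) : ℕ := ∑ i, k i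

/-- `M₂ = Σ kᵢ(kᵢ−1)`. -/
def M2 {n : ℕ} (k : Fin n → ℕ) : ℕ := ∑ i, k i * (k i - 1)

/-- `M₃ = Σ kᵢ(kᵢ−1)(kᵢ−2)`. -/
def M3 {n : ℕ} (k : Fin n → ℕ) : ℕ := ∑ i, k i * (k i - 1) * (k i - 2)

/-- The maximum degree. -/
def kmax {n : ℕ} (k : Fin n → ℕ) : ℕ := Finset.univ.sup k

/-- `Q` is an unordered partition of the point set into parts of size `r`. -/
def IsPartition {n : ℕ} (r : ℕ) (k : Fin n → ℕ) (Q : Finset (Finset (Pts k))) : Prop :=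
  (∀ U ∈ Q, U.card = r) ∧ ∀ p : Pts k, ∃! U, U ∈ Q ∧ p ∈ U

/-- `Λ_r(k)`, the set of partitions of the points into parts of size `r`. -/
def Lam {n : ℕ} (r : ℕ) (k : Fin n → ℕ) : Set (Finset (Finset (Pts k))) :=
  {Q | IsPartition r k Q}

/-- `Λ_r(k)` as a finset. -/
noncomputable def LamFinset {n : ℕ} (r : ℕ) (k : Fin n → ℕ) :
    Finset (Finset (Finset (Pts k))) :=
  Finset.univ.filter fun Q => IsPartition r k Q

/-- The set of vertices of the edge of `G(Q)` corresponding to a part `U`. -/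
def vset {n : ℕ} {k : Fin n → ℕ} (U : Finset (Pts k)) : Finset (Fin n) :=
  U.image Sigma.fst

/-- Multiplicity of vertex `i` in the edge corresponding to a part `U`. -/
def mult {n : ℕ} {k : Fin n → ℕ} (U : Finset (Pts k)) (i : Fin n) : ℕ :=
  (U.filter fun p => p.1 = i).card

/-- `U` contains a loop: two distinct points lying in the same cell. -/
def HasLoop {n : ℕ} {k : Fin n → ℕ} (U : Finset (Pts k)) : Prop :=
  ∃ x ∈ U, ∃ y ∈ U, x ≠ y ∧ x.1 = y.1

/-- The number of parts of `Q` which contain a loop. -/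
noncomputable def nloops {n : ℕ} {k : Fin n → ℕ} (Q : Finset (Finset (Pts k))) : ℕ :=
  (Q.filter fun U => HasLoop U).card

/-- `N = max(⌈log M⌉, ⌈9(r−1)M₂/M⌉)`. -/
noncomputable def Nbound {n : ℕ} (r : ℕ) (k : Fin n → ℕ) : ℕ :=
  max ⌈Real.log (Mtot k)⌉₊ ⌈(9 * ((r : ℝ) - 1) * (M2 k : ℝ)) / (Mtot k : ℝ)⌉₊

/-- `Λ_r⁺(k)`: partitions satisfying properties (i)–(iv). -/
noncomputable def LamPlus {n : ℕ} (r : ℕ) (k : Fin n → ℕ) :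
    Set (Finset (Finset (Pts k))) :=
  {Q | IsPartition r k Q ∧
    (∀ U ∈ Q, ∀ i, mult U i ≤ 2) ∧
    (∀ U ∈ Q, ∀ i j, mult U i = 2 → mult U j = 2 → i = j) ∧
    (∀ U ∈ Q, ∀ W ∈ Q, U ≠ W → (vset U ∩ vset W).card ≤ 2) ∧
    nloops Q ≤ Nbound r k}

/-- `C_ℓ`: partitions in `Λ_r⁺(k)` with exactly `ℓ` parts containing a loop. -/
noncomputable def Cset {n : ℕ} (r : ℕ) (k : Fin n → ℕ) (ℓ : ℕ) :
    Set (Finset (Finset (Pts k))) :=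
  {Q ∈ LamPlus r k | nloops Q = ℓ}

/-- The result of an ℓ-switching replacing parts `U`, `W₁`, `W₂`. -/
def switchResult {n : ℕ} {k : Fin n → ℕ} (Q : Finset (Finset (Pts k)))
    (U W₁ W₂ : Finset (Pts k)) (x₁ x₂ y₁ y₂ : Pts k) : Finset (Finset (Pts k)) :=
  (Q \ {U, W₁, W₂}) ∪
    {(U \ {x₁, x₂}) ∪ {y₁, y₂}, (W₁ \ {y₁}) ∪ {x₁}, (W₂ \ {y₂}) ∪ {x₂}}

/-- `(x₁,x₂,y₁,y₂)` specifies an ℓ-switching in `Q` with parts `U`, `W₁`, `W₂`. -/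
def IsSwitching {n : ℕ} {k : Fin n → ℕ} (Q : Finset (Finset (Pts k)))
    (U W₁ W₂ : Finset (Pts k)) (x₁ x₂ y₁ y₂ : Pts k) : Prop :=
  U ∈ Q ∧ W₁ ∈ Q ∧ W₂ ∈ Q ∧ U ≠ W₁ ∧ U ≠ W₂ ∧ W₁ ≠ W₂ ∧
  x₁ ∈ U ∧ x₂ ∈ U ∧ x₁ ≠ x₂ ∧ x₁.1 = x₂.1 ∧
  y₁ ∈ W₁ ∧ y₂ ∈ W₂ ∧ y₁.1 ≠ y₂.1

/-- The result of a reverse ℓ-switching replacing parts `Û`, `Ŵ₁`, `Ŵ₂`. -/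
def revSwitchResult {n : ℕ} {k : Fin n → ℕ} (Q' : Finset (Finset (Pts k)))
    (Uh W₁h W₂h : Finset (Pts k)) (x₁ x₂ y₁ y₂ : Pts k) : Finset (Finset (Pts k)) :=
  (Q' \ {Uh, W₁h, W₂h}) ∪
    {(Uh \ {y₁, y₂}) ∪ {x₁, x₂}, (W₁h \ {x₁}) ∪ {y₁}, (W₂h \ {x₂}) ∪ {y₂}}

/-- `(x₁,x₂,y₁,y₂)` specifies a reverse ℓ-switching in `Q'` with parts `Û`, `Ŵ₁`, `Ŵ₂`. -/
def IsRevSwitching {n : ℕ} {k : Fin n → ℕ} (Q' : Finset (Finset (Pts k)))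
    (Uh W₁h W₂h : Finset (Pts k)) (x₁ x₂ y₁ y₂ : Pts k) : Prop :=
  Uh ∈ Q' ∧ W₁h ∈ Q' ∧ W₂h ∈ Q' ∧ Uh ≠ W₁h ∧ Uh ≠ W₂h ∧ W₁h ≠ W₂h ∧
  x₁ ∈ W₁h ∧ x₂ ∈ W₂h ∧ x₁.1 = x₂.1 ∧
  y₁ ∈ Uh ∧ y₂ ∈ Uh ∧ y₁ ≠ y₂ ∧ y₁.1 ≠ y₂.1

/-- `Q` is simple: every edge of `G(Q)` consists of distinct vertices and all
edges are distinct. -/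
def SimpleQ {n : ℕ} {k : Fin n → ℕ} (Q : Finset (Finset (Pts k))) : Prop :=
  (∀ U ∈ Q, (vset U).card = U.card) ∧
  ∀ U ∈ Q, ∀ W ∈ Q, U ≠ W → vset U ≠ vset W

/-- `|H_r(k)|`: the number of simple `r`-uniform hypergraphs on `{1,…,n}` with
degree sequence `k`, a hypergraph being recorded as its (distinct) edge set. -/
noncomputable def Hcount (r : ℕ) {n : ℕ} (k : Fin n → ℕ) : ℕ :=
  Set.ncard {E : Finset (Finset (Fin n)) |
    (∀ e ∈ E, e.card = r) ∧ ∀ i, (E.filter fun e => i ∈ e).card = k i}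

section Aux

lemma aux_perm_count {P τ : Type*} [Fintype P] [DecidableEq P] [Fintype τ] (a b : τ → P)
    (ha : Function.Injective a) :
    (Finset.univ.filter fun g : Equiv.Perm P => ∀ t, g (a t) = b t).card *
      (Fintype.card P).descFactorial (Fintype.card τ) ≤ (Fintype.card P).factorial := by
  by_cases hb : Function.Injective b
  · have key : ∀ e : τ ↪ P,
        (Finset.univ.filter fun g : Equiv.Perm P => ∀ t, g (a t) = b t).card ≤
        (Finset.univ.filter fun g : Equiv.Perm P => ∀ t, g (a t) = e t).card := by
      intro e
      obtain ⟨h, hh⟩ : ∃ h : Equiv.Perm P, ∀ t, h (b t) = e t := by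
        let e1 := Equiv.ofInjective b hb
        let e2 := Equiv.ofInjective e e.injective
        let f : {x // x ∈ Set.range b} ≃ {x // x ∈ Set.range e} := e1.symm.trans e2
        refine ⟨f.extendSubtype, fun t => ?_⟩
        rw [Equiv.extendSubtype_apply_of_mem f (b t) ⟨t, rfl⟩]
        have : (⟨b t, ⟨t, rfl⟩⟩ : {x // x ∈ Set.range b}) = e1 t := rfl
        simp only [f, this, Equiv.trans_apply, Equiv.symm_apply_apply]
        rfl
      apply Finset.card_le_card_of_injOn (fun g => h * g)
      · intro g hg
        simp only [Finset.coe_filter, Finset.mem_univ, true_and, Set.mem_ofPred_eq] at hg ⊢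
        intro t
        simp [hg t, hh t]
      · intro g _ g' _ hgg
        exact mul_left_cancel hgg
    have h1 : ∑ e : τ ↪ P, (Finset.univ.filter fun g : Equiv.Perm P => ∀ t, g (a t) = e t).card
        ≤ (Fintype.card P).factorial := by
      rw [← Finset.card_biUnion]
      · calc _ ≤ (Finset.univ : Finset (Equiv.Perm P)).card := Finset.card_le_univ _
          _ = _ := by rw [Finset.card_univ, Fintype.card_perm]
      · intro e _ e' _ hee
        rw [Function.onFun, Finset.disjoint_left]
        intro g hg hg'
        simp only [Finset.mem_filter, Finset.mem_univ, true_and] at hg hg'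
        exact hee (by ext t; rw [← hg t, ← hg' t])
    calc _ = ∑ e : τ ↪ P,
          (Finset.univ.filter fun g : Equiv.Perm P => ∀ t, g (a t) = b t).card := by
            rw [Finset.sum_const, Finset.card_univ, Fintype.card_embedding_eq, smul_eq_mul,
              mul_comm]
      _ ≤ _ := Finset.sum_le_sum fun e _ => key e
      _ ≤ _ := h1
  · have : (Finset.univ.filter fun g : Equiv.Perm P => ∀ t, g (a t) = b t) = ∅ := by
      ext g
      simp only [Finset.mem_filter, Finset.mem_univ, true_and, Finset.notMem_empty, iff_false]
      intro hg
      apply hb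
      intro t t' htt
      rw [← hg t, ← hg t'] at htt
      exact ha (g.injective htt)
    rw [this]
    simp

lemma aux_union_count {P τ : Type*} [Fintype P] [DecidableEq P] [Fintype τ] [DecidableEq τ]
    (A B : Finset (τ → P)) (hA : ∀ a ∈ A, Function.Injective a) :
    (Finset.univ.filter fun g : Equiv.Perm P => ∃ a ∈ A, (fun t => g (a t)) ∈ B).card *
      (Fintype.card P).descFactorial (Fintype.card τ) ≤
      A.card * B.card * (Fintype.card P).factorial := by
  have h1 : (Finset.univ.filter fun g : Equiv.Perm P => ∃ a ∈ A, (fun t => g (a t)) ∈ B) ⊆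
      (A ×ˢ B).biUnion fun ab =>
        Finset.univ.filter fun g : Equiv.Perm P => ∀ t, g (ab.1 t) = ab.2 t := by
    intro g hg
    simp only [Finset.mem_filter, Finset.mem_univ, true_and] at hg
    obtain ⟨a, ha, hb⟩ := hg
    simp only [Finset.mem_biUnion, Finset.mem_filter, Finset.mem_univ, true_and]
    exact ⟨(a, fun t => g (a t)), Finset.mem_product.2 ⟨ha, hb⟩, fun t => rfl⟩
  calc _ ≤ (∑ ab ∈ A ×ˢ B, (Finset.univ.filter fun g : Equiv.Perm P =>
          ∀ t, g (ab.1 t) = ab.2 t).card) *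
        (Fintype.card P).descFactorial (Fintype.card τ) :=
        Nat.mul_le_mul_right _ ((Finset.card_le_card h1).trans Finset.card_biUnion_le)
    _ = ∑ ab ∈ A ×ˢ B, (Finset.univ.filter fun g : Equiv.Perm P =>
          ∀ t, g (ab.1 t) = ab.2 t).card *
        (Fintype.card P).descFactorial (Fintype.card τ) := Finset.sum_mul _ _ _
    _ ≤ ∑ ab ∈ A ×ˢ B, (Fintype.card P).factorial :=
        Finset.sum_le_sum fun ab hab =>
          aux_perm_count ab.1 ab.2 (hA _ (Finset.mem_product.1 hab).1)
    _ = _ := by rw [Finset.sum_const, Finset.card_product, smul_eq_mul]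

/-- pair version -/
lemma aux_pair_count {P ι : Type*} [Fintype P] [DecidableEq P] [Fintype ι] [DecidableEq ι]
    (A : Finset (ι → P × P)) (L : Finset (P × P))
    (hA : ∀ a ∈ A, Function.Injective
      (Sum.elim (fun i => (a i).1) (fun i => (a i).2) : ι ⊕ ι → P)) :
    (Finset.univ.filter fun g : Equiv.Perm P =>
      ∃ a ∈ A, ∀ i, (g (a i).1, g (a i).2) ∈ L).card *
      (Fintype.card P).descFactorial (2 * Fintype.card ι) ≤
      A.card * L.card ^ Fintype.card ι * (Fintype.card P).factorial := by
  let F : (ι → P × P) → (ι ⊕ ι → P) := fun a => Sum.elim (fun i => (a i).1) (fun i => (a i).2)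
  have h := aux_union_count (A.image F) ((Fintype.piFinset fun _ : ι => L).image F)
    (by
      intro a ha
      obtain ⟨a', ha', rfl⟩ := Finset.mem_image.1 ha
      exact hA a' ha')
  rw [Fintype.card_sum, ← two_mul] at h
  refine le_trans (Nat.mul_le_mul_right _ (Finset.card_le_card ?_)) (h.trans ?_)
  · intro g hg
    simp only [Finset.mem_filter, Finset.mem_univ, true_and] at hg ⊢
    obtain ⟨a, ha, hb⟩ := hg
    refine ⟨F a, Finset.mem_image_of_mem _ ha, Finset.mem_image.2
      ⟨fun i => (g (a i).1, g (a i).2), Fintype.mem_piFinset.2 hb, ?_⟩⟩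
    funext t
    cases t <;> rfl
  · apply Nat.mul_le_mul_right
    apply Nat.mul_le_mul Finset.card_image_le
    refine Finset.card_image_le.trans ?_
    rw [Fintype.card_piFinset, Finset.prod_const, Finset.card_univ]

/-- the action of a permutation on set systems -/
def actQ {P : Type*} (g : Equiv.Perm P) : Finset (Finset P) ≃ Finset (Finset P) :=
  g.finsetCongr.finsetCongr

lemma mem_actQ {P : Type*} (g : Equiv.Perm P) (Q : Finset (Finset P)) (V : Finset P) :
    V ∈ actQ g Q ↔ ∃ U ∈ Q, U.map g.toEmbedding = V := by
  unfold actQ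
  rw [Equiv.finsetCongr_apply, Finset.mem_map]
  rfl

lemma actQ_partition {n r : ℕ} {k : Fin n → ℕ} (g : Equiv.Perm (Pts k))
    {Q : Finset (Finset (Pts k))} (hQ : IsPartition r k Q) : IsPartition r k (actQ g Q) := by
  refine ⟨?_, ?_⟩
  · intro V hV
    obtain ⟨U, hU, rfl⟩ := (mem_actQ g Q V).1 hV
    rw [Finset.card_map]
    exact hQ.1 U hU
  · intro p
    obtain ⟨U, ⟨hU, hpU⟩, huniq⟩ := hQ.2 (g.symm p)
    refine ⟨U.map g.toEmbedding, ⟨(mem_actQ g Q _).2 ⟨U, hU, rfl⟩, ?_⟩, ?_⟩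
    · rw [Finset.mem_map_equiv]; exact hpU
    · rintro V ⟨hV, hpV⟩
      obtain ⟨U', hU', rfl⟩ := (mem_actQ g Q V).1 hV
      rw [Finset.mem_map_equiv] at hpV
      rw [huniq U' ⟨hU', hpV⟩]

lemma aux_average {n r : ℕ} {k : Fin n → ℕ} (Bad : Finset (Finset (Finset (Pts k))))
    (hB : Bad ⊆ LamFinset r k) (ε : ℝ)
    (h : ∀ Q, IsPartition r k Q →
      ((Finset.univ.filter fun g : Equiv.Perm (Pts k) => actQ g Q ∈ Bad).card : ℝ) ≤
        ε * (Fintype.card (Pts k)).factorial) :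
    (Bad.card : ℝ) ≤ ε * (LamFinset r k).card := by
  have h1 : ∀ g : Equiv.Perm (Pts k),
      Bad.card ≤ ((LamFinset r k).filter fun Q => actQ g Q ∈ Bad).card := by
    intro g
    apply Finset.card_le_card_of_injOn (fun Q => (actQ g).symm Q)
    · intro Q hQ
      simp only [Finset.coe_filter, Set.mem_ofPred_eq, Equiv.apply_symm_apply]
      refine ⟨?_, hQ⟩
      have hQ2 := hB hQ
      simp only [LamFinset, Finset.mem_filter, Finset.mem_univ, true_and] at hQ2 ⊢
      exact actQ_partition g.symm hQ2
    · exact (actQ g).symm.injective.injOn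
  have h2 : ∑ g : Equiv.Perm (Pts k), ((LamFinset r k).filter fun Q => actQ g Q ∈ Bad).card =
      ∑ Q ∈ LamFinset r k,
        (Finset.univ.filter fun g : Equiv.Perm (Pts k) => actQ g Q ∈ Bad).card := by
    simp only [Finset.card_filter]
    rw [Finset.sum_comm]
  have h3 : (Fintype.card (Pts k)).factorial * Bad.card ≤ ∑ Q ∈ LamFinset r k,
        (Finset.univ.filter fun g : Equiv.Perm (Pts k) => actQ g Q ∈ Bad).card := by
    rw [← h2, ← Fintype.card_perm, ← smul_eq_mul, ← Finset.card_univ, ← Finset.sum_const]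
    exact Finset.sum_le_sum fun g _ => h1 g
  have h4 : ((Fintype.card (Pts k)).factorial : ℝ) * Bad.card ≤
      ∑ Q ∈ LamFinset r k, ε * (Fintype.card (Pts k)).factorial := by
    refine le_trans (by exact_mod_cast h3) (?_ : ((∑ Q ∈ LamFinset r k,
        (Finset.univ.filter fun g : Equiv.Perm (Pts k) => actQ g Q ∈ Bad).card : ℕ) : ℝ) ≤ _)
    rw [Nat.cast_sum]
    apply Finset.sum_le_sum
    intro Q hQ
    apply h Q
    simpa [LamFinset] using hQ
  rw [Finset.sum_const, nsmul_eq_mul] at h4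
  have h5 : (0 : ℝ) < (Fintype.card (Pts k)).factorial := by exact_mod_cast Nat.factorial_pos _
  nlinarith

lemma Lam_nonempty {n r : ℕ} {k : Fin n → ℕ} (hd : r ∣ Mtot k) :
    (LamFinset r k).Nonempty := by
  obtain ⟨m, hm⟩ := hd
  have hc : Fintype.card (Pts k) = Fintype.card (Fin m × Fin r) := by
    simp only [Pts, Fintype.card_sigma, Fintype.card_fin, Fintype.card_prod]
    rw [mul_comm m r, ← hm]; rfl
  let e := Fintype.equivOfCardEq hc
  refine ⟨Finset.univ.image fun j : Fin m =>
    (Finset.univ : Finset (Fin r)).image fun l => e.symm (j, l), ?_⟩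
  simp only [LamFinset, Finset.mem_filter, Finset.mem_univ, true_and]
  refine ⟨?_, ?_⟩
  · intro U hU
    obtain ⟨j, _, rfl⟩ := Finset.mem_image.1 hU
    rw [Finset.card_image_of_injective _ (fun l l' h => by simpa using h)]
    simp
  · intro p
    refine ⟨_, ⟨Finset.mem_image.2 ⟨(e p).1, Finset.mem_univ _, rfl⟩, ?_⟩, ?_⟩
    · simp only [Finset.mem_image, Finset.mem_univ, true_and]
      exact ⟨(e p).2, by simp⟩
    · rintro V ⟨hV, hp⟩
      obtain ⟨j, _, rfl⟩ := Finset.mem_image.1 hV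
      simp only [Finset.mem_image, Finset.mem_univ, true_and] at hp
      obtain ⟨l, rfl⟩ := hp
      simp

lemma card_Pts {n : ℕ} (k : Fin n → ℕ) : Fintype.card (Pts k) = Mtot k := by
  simp [Pts, Fintype.card_sigma, Mtot]

/-- ordered pairs of distinct points in a common cell -/
def Lset {n : ℕ} (k : Fin n → ℕ) : Finset (Pts k × Pts k) :=
  Finset.univ.filter fun p => p.1 ≠ p.2 ∧ p.1.1 = p.2.1

lemma card_Lset {n : ℕ} (k : Fin n → ℕ) : (Lset k).card ≤ M2 k := by
  have h : Lset k ⊆ Finset.univ.biUnion fun i : Fin n =>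
      ((Finset.univ : Finset (Fin (k i))).offDiag).image
        fun ab => ((⟨i, ab.1⟩, ⟨i, ab.2⟩) : Pts k × Pts k) := by
    rintro ⟨⟨i, a⟩, ⟨j, b⟩⟩ h
    simp only [Lset, Finset.mem_filter, Finset.mem_univ, true_and] at h
    obtain ⟨h1, h2⟩ := h
    subst h2
    rw [Finset.mem_biUnion]
    refine ⟨i, Finset.mem_univ _, Finset.mem_image.2 ⟨(a, b), ?_, rfl⟩⟩
    rw [Finset.mem_offDiag]
    exact ⟨Finset.mem_univ _, Finset.mem_univ _, fun hab => h1 (by rw [show a = b from hab])⟩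
  refine (Finset.card_le_card h).trans (Finset.card_biUnion_le.trans ?_)
  unfold M2
  apply Finset.sum_le_sum
  intro i _
  refine Finset.card_image_le.trans ?_
  rw [Finset.offDiag_card, Finset.card_univ, Fintype.card_fin, Nat.mul_sub, mul_one]

/-- triples of points in a common cell -/
def Tset {n : ℕ} (k : Fin n → ℕ) : Finset (Fin 3 → Pts k) :=
  Finset.univ.filter fun b => ∃ i, ∀ t, (b t).1 = i

lemma card_Tset {n : ℕ} (k : Fin n → ℕ) : (Tset k).card ≤ ∑ i, k i ^ 3 := by
  have h : Tset k ⊆ Finset.univ.biUnion fun i : Fin n =>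
      (Finset.univ : Finset (Fin 3 → Fin (k i))).image
        fun c => (fun t => (⟨i, c t⟩ : Pts k)) := by
    intro b hb
    simp only [Tset, Finset.mem_filter, Finset.mem_univ, true_and] at hb
    obtain ⟨i, hi⟩ := hb
    rw [Finset.mem_biUnion]
    refine ⟨i, Finset.mem_univ _, Finset.mem_image.2
      ⟨fun t => Fin.cast (by rw [hi t]) (b t).2, Finset.mem_univ _, ?_⟩⟩
    funext t
    have key : ∀ (x : Pts k) (h : x.1 = i), (⟨i, Fin.cast (by rw [h]) x.2⟩ : Pts k) = x := by
      rintro ⟨j, x⟩ h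
      subst h
      rfl
    exact key (b t) (hi t)
  refine (Finset.card_le_card h).trans (Finset.card_biUnion_le.trans ?_)
  apply Finset.sum_le_sum
  intro i _
  refine Finset.card_image_le.trans ?_
  simp

lemma partition_disj {n r : ℕ} {k : Fin n → ℕ} {Q : Finset (Finset (Pts k))}
    (hQ : IsPartition r k Q) {U W : Finset (Pts k)} (hU : U ∈ Q) (hW : W ∈ Q) {p : Pts k}
    (h1 : p ∈ U) (h2 : p ∈ W) : U = W :=
  (hQ.2 p).unique ⟨hU, h1⟩ ⟨hW, h2⟩

lemma partition_card {n r : ℕ} {k : Fin n → ℕ} {Q : Finset (Finset (Pts k))}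
    (hQ : IsPartition r k Q) : Q.card * r = Mtot k := by
  have h1 : Q.biUnion id = Finset.univ := by
    ext p
    simp only [Finset.mem_biUnion, id, Finset.mem_univ, iff_true]
    obtain ⟨U, hU, _⟩ := hQ.2 p
    exact ⟨U, hU⟩
  rw [← card_Pts, ← Finset.card_univ, ← h1, Finset.card_biUnion]
  · rw [Finset.sum_congr rfl (fun U hU => show (id U).card = r from hQ.1 U hU), Finset.sum_const,
      smul_eq_mul]
  · intro U hU W hW hUW
    rw [Function.onFun, Finset.disjoint_left]
    exact fun p h1 h2 => hUW (partition_disj hQ hU hW h1 h2)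

lemma cell_inj {n : ℕ} {ι : Type*} {k : Fin n → ℕ} (g : Equiv.Perm (Pts k))
    (c : ι → Pts k × Pts k)
    (v : ι → Fin n) (hv : Function.Injective v) (h1 : ∀ i, (c i).1.1 = v i)
    (h2 : ∀ i, (c i).2.1 = v i) (h3 : ∀ i, (c i).1 ≠ (c i).2) :
    Function.Injective
      (Sum.elim (fun i => g.symm (c i).1) (fun i => g.symm (c i).2) : ι ⊕ ι → Pts k) := by
  apply Function.Injective.sumElim
  · intro i j hij
    have := congrArg Sigma.fst (g.symm.injective hij)
    rw [h1, h1] at this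
    exact hv this
  · intro i j hij
    have := congrArg Sigma.fst (g.symm.injective hij)
    rw [h2, h2] at this
    exact hv this
  · intro i j hij
    have h := g.symm.injective hij
    have := congrArg Sigma.fst h
    rw [h1, h2] at this
    have := hv this
    subst this
    exact h3 i h

lemma event1 {n r : ℕ} {k : Fin n → ℕ} {Q : Finset (Finset (Pts k))}
    (hQ : IsPartition r k Q) :
    (Finset.univ.filter fun g : Equiv.Perm (Pts k) =>
      ∃ U ∈ Q, ∃ i, 3 ≤ mult (U.map g.toEmbedding) i).card * (Mtot k).descFactorial 3 ≤
    (Q.card * r ^ 3) * (∑ i, k i ^ 3) * (Mtot k).factorial := by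
  let A : Finset (Fin 3 → Pts k) :=
    (Q.biUnion fun U => Fintype.piFinset fun _ : Fin 3 => U).filter Function.Injective
  have h := aux_union_count A (Tset k) (fun a ha => (Finset.mem_filter.1 ha).2)
  rw [Fintype.card_fin, card_Pts] at h
  refine le_trans (Nat.mul_le_mul_right _ (Finset.card_le_card ?_)) (h.trans ?_)
  · intro g hg
    simp only [Finset.mem_filter, Finset.mem_univ, true_and] at hg ⊢
    obtain ⟨U, hU, i, hi⟩ := hg
    obtain ⟨T, hT, hT3⟩ := Finset.exists_subset_card_eq hi
    let e := (Finset.equivFinOfCardEq hT3).symm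
    have he : ∀ t, (e t : Pts k) ∈ U.map g.toEmbedding ∧ (e t : Pts k).1 = i := by
      intro t
      simpa only [Finset.mem_filter] using hT (e t).2
    refine ⟨fun t => g.symm (e t), ?_, ?_⟩
    · rw [Finset.mem_filter, Finset.mem_biUnion]
      refine ⟨⟨U, hU, Fintype.mem_piFinset.2 fun t => ?_⟩, ?_⟩
      · exact Finset.mem_map_equiv.1 (he t).1
      · intro t t' htt
        exact e.injective (Subtype.ext (g.symm.injective htt))
    · simp only [Tset, Finset.mem_filter, Finset.mem_univ, true_and, Equiv.apply_symm_apply]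
      exact ⟨i, fun t => (he t).2⟩
  · apply Nat.mul_le_mul_right
    apply Nat.mul_le_mul _ (card_Tset k)
    refine (Finset.card_filter_le _ _).trans (Finset.card_biUnion_le.trans ?_)
    rw [← smul_eq_mul, ← Finset.sum_const]
    apply Finset.sum_le_sum
    intro U hU
    rw [Fintype.card_piFinset]
    simp [hQ.1 U hU]

lemma event2 {n r : ℕ} {k : Fin n → ℕ} {Q : Finset (Finset (Pts k))}
    (hQ : IsPartition r k Q) :
    (Finset.univ.filter fun g : Equiv.Perm (Pts k) =>
      ∃ U ∈ Q, ∃ i j, i ≠ j ∧ mult (U.map g.toEmbedding) i = 2 ∧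
        mult (U.map g.toEmbedding) j = 2).card * (Mtot k).descFactorial 4 ≤
    (Q.card * (r * r) ^ 2) * M2 k ^ 2 * (Mtot k).factorial := by
  let A : Finset (Fin 2 → Pts k × Pts k) :=
    (Q.biUnion fun U => Fintype.piFinset fun _ : Fin 2 => U ×ˢ U).filter fun a =>
      Function.Injective
        (Sum.elim (fun i => (a i).1) (fun i => (a i).2) : Fin 2 ⊕ Fin 2 → Pts k)
  have h := aux_pair_count A (Lset k) (fun a ha => (Finset.mem_filter.1 ha).2)
  rw [Fintype.card_fin, card_Pts] at h
  refine le_trans (Nat.mul_le_mul_right _ (Finset.card_le_card ?_)) (h.trans ?_)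
  · intro g hg
    simp only [Finset.mem_filter, Finset.mem_univ, true_and] at hg ⊢
    obtain ⟨U, hU, i, j, hij, hi, hj⟩ := hg
    obtain ⟨x1, x2, hx, hxs⟩ := Finset.card_eq_two.1 hi
    obtain ⟨y1, y2, hy, hys⟩ := Finset.card_eq_two.1 hj
    have e1 : x1 ∈ U.map g.toEmbedding ∧ x1.1 = i := by
      refine (Finset.mem_filter (p := fun p : Pts k => p.1 = i)).1 ?_
      rw [hxs]; simp
    have e2 : x2 ∈ U.map g.toEmbedding ∧ x2.1 = i := by
      refine (Finset.mem_filter (p := fun p : Pts k => p.1 = i)).1 ?_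
      rw [hxs]; simp
    have e3 : y1 ∈ U.map g.toEmbedding ∧ y1.1 = j := by
      refine (Finset.mem_filter (p := fun p : Pts k => p.1 = j)).1 ?_
      rw [hys]; simp
    have e4 : y2 ∈ U.map g.toEmbedding ∧ y2.1 = j := by
      refine (Finset.mem_filter (p := fun p : Pts k => p.1 = j)).1 ?_
      rw [hys]; simp
    let c : Fin 2 → Pts k × Pts k := ![(x1, x2), (y1, y2)]
    refine ⟨fun t => (g.symm (c t).1, g.symm (c t).2), ?_, ?_⟩
    · rw [Finset.mem_filter, Finset.mem_biUnion]
      refine ⟨⟨U, hU, Fintype.mem_piFinset.2 fun t => ?_⟩, ?_⟩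
      · rw [Finset.mem_product]
        fin_cases t
        · exact ⟨Finset.mem_map_equiv.1 e1.1, Finset.mem_map_equiv.1 e2.1⟩
        · exact ⟨Finset.mem_map_equiv.1 e3.1, Finset.mem_map_equiv.1 e4.1⟩
      · apply cell_inj g c ![i, j]
        · intro t t' htt
          fin_cases t <;> fin_cases t'
          · rfl
          · exact absurd htt hij
          · exact absurd htt.symm hij
          · rfl
        · intro t; fin_cases t
          exacts [e1.2, e3.2]
        · intro t; fin_cases t
          exacts [e2.2, e4.2]
        · intro t; fin_cases t
          exacts [hx, hy]
    · intro t
      simp only [Lset, Finset.mem_filter, Finset.mem_univ, true_and, Equiv.apply_symm_apply]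
      fin_cases t
      · exact ⟨hx, e1.2.trans e2.2.symm⟩
      · exact ⟨hy, e3.2.trans e4.2.symm⟩
  · apply Nat.mul_le_mul_right
    refine Nat.mul_le_mul ?_ (Nat.pow_le_pow_left (card_Lset k) 2)
    refine (Finset.card_filter_le _ _).trans (Finset.card_biUnion_le.trans ?_)
    rw [← smul_eq_mul, ← Finset.sum_const]
    apply Finset.sum_le_sum
    intro U hU
    rw [Fintype.card_piFinset]
    simp [hQ.1 U hU]

lemma event3 {n r : ℕ} {k : Fin n → ℕ} {Q : Finset (Finset (Pts k))}
    (hQ : IsPartition r k Q) :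
    (Finset.univ.filter fun g : Equiv.Perm (Pts k) =>
      ∃ U ∈ Q, ∃ W ∈ Q, U ≠ W ∧
        3 ≤ (vset (U.map g.toEmbedding) ∩ vset (W.map g.toEmbedding)).card).card *
        (Mtot k).descFactorial 6 ≤
    (Q.card ^ 2 * (r * r) ^ 3) * M2 k ^ 3 * (Mtot k).factorial := by
  let A : Finset (Fin 3 → Pts k × Pts k) :=
    ((Q ×ˢ Q).biUnion fun UW => Fintype.piFinset fun _ : Fin 3 => UW.1 ×ˢ UW.2).filter fun a =>
      Function.Injective
        (Sum.elim (fun i => (a i).1) (fun i => (a i).2) : Fin 3 ⊕ Fin 3 → Pts k)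
  have h := aux_pair_count A (Lset k) (fun a ha => (Finset.mem_filter.1 ha).2)
  rw [Fintype.card_fin, card_Pts] at h
  refine le_trans (Nat.mul_le_mul_right _ (Finset.card_le_card ?_)) (h.trans ?_)
  · intro g hg
    simp only [Finset.mem_filter, Finset.mem_univ, true_and] at hg ⊢
    obtain ⟨U, hU, W, hW, hUW, h3⟩ := hg
    obtain ⟨T, hT, hT3⟩ := Finset.exists_subset_card_eq h3
    let e := (Finset.equivFinOfCardEq hT3).symm
    have he : ∀ t, ∃ x y : Pts k, (x ∈ U.map g.toEmbedding ∧ x.1 = e t) ∧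
        (y ∈ W.map g.toEmbedding ∧ y.1 = e t) := by
      intro t
      have := hT (e t).2
      rw [Finset.mem_inter, vset, vset, Finset.mem_image, Finset.mem_image] at this
      obtain ⟨⟨x, hx⟩, ⟨y, hy⟩⟩ := this
      exact ⟨x, y, hx, hy⟩
    choose x y hx hy using he
    have hne : ∀ t, x t ≠ y t := by
      intro t hxy
      apply hUW
      have h1 := Finset.mem_map_equiv.1 (hx t).1
      have h2 := Finset.mem_map_equiv.1 (hy t).1
      rw [← hxy] at h2
      exact partition_disj hQ hU hW h1 h2
    refine ⟨fun t => (g.symm (x t), g.symm (y t)), ?_, ?_⟩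
    · rw [Finset.mem_filter, Finset.mem_biUnion]
      refine ⟨⟨(U, W), Finset.mem_product.2 ⟨hU, hW⟩, Fintype.mem_piFinset.2 fun t => ?_⟩, ?_⟩
      · rw [Finset.mem_product]
        exact ⟨Finset.mem_map_equiv.1 (hx t).1, Finset.mem_map_equiv.1 (hy t).1⟩
      · exact cell_inj g (fun t => (x t, y t)) (fun t => (e t : Fin n))
          (fun t t' htt => e.injective (Subtype.ext htt))
          (fun t => (hx t).2) (fun t => (hy t).2) hne
    · intro t
      simp only [Lset, Finset.mem_filter, Finset.mem_univ, true_and, Equiv.apply_symm_apply]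
      exact ⟨hne t, (hx t).2.trans (hy t).2.symm⟩
  · apply Nat.mul_le_mul_right
    refine Nat.mul_le_mul ?_ (Nat.pow_le_pow_left (card_Lset k) 3)
    refine (Finset.card_filter_le _ _).trans (Finset.card_biUnion_le.trans ?_)
    rw [sq, ← Finset.card_product, ← smul_eq_mul (Finset.card _), ← Finset.sum_const]
    apply Finset.sum_le_sum
    intro UW hUW
    rw [Finset.mem_product] at hUW
    rw [Fintype.card_piFinset]
    simp [hQ.1 _ hUW.1, hQ.1 _ hUW.2]

lemma event4a {n r s : ℕ} {k : Fin n → ℕ} {Q : Finset (Finset (Pts k))}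
    (hQ : IsPartition r k Q) (S : Finset (Finset (Pts k))) (hS : S ⊆ Q) (hs : S.card = s) :
    (Finset.univ.filter fun g : Equiv.Perm (Pts k) =>
      ∀ U ∈ S, HasLoop (U.map g.toEmbedding)).card * (Mtot k).descFactorial (2 * s) ≤
    (r * (r - 1)) ^ s * M2 k ^ s * (Mtot k).factorial := by
  let A : Finset ({U // U ∈ S} → Pts k × Pts k) :=
    Fintype.piFinset fun U : {U // U ∈ S} => U.1.offDiag
  have hA : ∀ a ∈ A, Function.Injective
      (Sum.elim (fun i => (a i).1) (fun i => (a i).2) : {U // U ∈ S} ⊕ {U // U ∈ S} → Pts k) := by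
    intro a ha
    have ha' : ∀ i, (a i).1 ∈ i.1 ∧ (a i).2 ∈ i.1 ∧ (a i).1 ≠ (a i).2 := fun i =>
      Finset.mem_offDiag.1 (Fintype.mem_piFinset.1 ha i)
    apply Function.Injective.sumElim
    · intro i j hij
      have hij : (a i).1 = (a j).1 := hij
      exact Subtype.ext (partition_disj hQ (hS i.2) (hS j.2) (ha' i).1 (hij ▸ (ha' j).1))
    · intro i j hij
      have hij : (a i).2 = (a j).2 := hij
      exact Subtype.ext (partition_disj hQ (hS i.2) (hS j.2) (ha' i).2.1 (hij ▸ (ha' j).2.1))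
    · intro i j hij
      have := Subtype.ext (partition_disj hQ (hS i.2) (hS j.2) (ha' i).1 (hij ▸ (ha' j).2.1))
      subst this
      exact (ha' i).2.2 hij
  have h := aux_pair_count A (Lset k) hA
  rw [Fintype.card_coe, card_Pts, hs] at h
  refine le_trans (Nat.mul_le_mul_right _ (Finset.card_le_card ?_)) (h.trans ?_)
  · intro g hg
    simp only [Finset.mem_filter, Finset.mem_univ, true_and] at hg ⊢
    have hg' : ∀ U : {U // U ∈ S}, ∃ x y : Pts k, x ∈ U.1.map g.toEmbedding ∧
        y ∈ U.1.map g.toEmbedding ∧ x ≠ y ∧ x.1 = y.1 := by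
      intro U
      obtain ⟨x, hx, y, hy, h⟩ := hg U.1 U.2
      exact ⟨x, y, hx, hy, h⟩
    choose x y hx hy hne hxy using hg'
    refine ⟨fun t => (g.symm (x t), g.symm (y t)), ?_, ?_⟩
    · refine Fintype.mem_piFinset.2 fun t => ?_
      rw [Finset.mem_offDiag]
      exact ⟨Finset.mem_map_equiv.1 (hx t), Finset.mem_map_equiv.1 (hy t),
        fun h => hne t (g.symm.injective h)⟩
    · intro t
      simp only [Lset, Finset.mem_filter, Finset.mem_univ, true_and, Equiv.apply_symm_apply]
      exact ⟨hne t, hxy t⟩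
  · apply Nat.mul_le_mul_right
    refine Nat.mul_le_mul ?_ (Nat.pow_le_pow_left (card_Lset k) s)
    rw [Fintype.card_piFinset]
    rw [Finset.prod_congr rfl (fun U _ => show (U : {U // U ∈ S}).1.offDiag.card = r * (r - 1) by
      rw [Finset.offDiag_card, hQ.1 _ (hS U.2), Nat.mul_sub, mul_one])]
    rw [Finset.prod_const, Finset.card_univ, Fintype.card_coe, hs]

lemma event4 {n r s : ℕ} {k : Fin n → ℕ} {Q : Finset (Finset (Pts k))}
    (hQ : IsPartition r k Q) :
    (Finset.univ.filter fun g : Equiv.Perm (Pts k) => s ≤ nloops (actQ g Q)).card *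
      (Mtot k).descFactorial (2 * s) ≤
    Q.card.choose s * ((r * (r - 1)) ^ s * M2 k ^ s * (Mtot k).factorial) := by
  have h1 : (Finset.univ.filter fun g : Equiv.Perm (Pts k) => s ≤ nloops (actQ g Q)) ⊆
      (Q.powersetCard s).biUnion fun S => Finset.univ.filter fun g : Equiv.Perm (Pts k) =>
        ∀ U ∈ S, HasLoop (U.map g.toEmbedding) := by
    intro g hg
    simp only [Finset.mem_filter, Finset.mem_univ, true_and] at hg
    have h2 : nloops (actQ g Q) ≤
        (Q.filter fun U => HasLoop (U.map g.toEmbedding)).card := by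
      refine le_trans (Finset.card_le_card (?_ : _ ⊆
        (Q.filter fun U => HasLoop (U.map g.toEmbedding)).image
          fun U => U.map g.toEmbedding)) Finset.card_image_le
      intro V hV
      rw [Finset.mem_filter, mem_actQ] at hV
      obtain ⟨⟨U, hU, rfl⟩, hV⟩ := hV
      exact Finset.mem_image.2 ⟨U, Finset.mem_filter.2 ⟨hU, hV⟩, rfl⟩
    obtain ⟨S, hS, hSs⟩ := Finset.exists_subset_card_eq (hg.trans h2)
    rw [Finset.mem_biUnion]
    refine ⟨S, Finset.mem_powersetCard.2 ⟨hS.trans (Finset.filter_subset _ _), hSs⟩, ?_⟩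
    simp only [Finset.mem_filter, Finset.mem_univ, true_and]
    exact fun U hU => (Finset.mem_filter.1 (hS hU)).2
  refine (Nat.mul_le_mul_right _ ((Finset.card_le_card h1).trans
    Finset.card_biUnion_le)).trans ?_
  rw [Finset.sum_mul, ← Finset.card_powersetCard, ← smul_eq_mul (Finset.card _) (_ * _), ← Finset.sum_const]
  apply Finset.sum_le_sum
  intro S hS
  rw [Finset.mem_powersetCard] at hS
  exact event4a hQ S hS.1 hS.2

lemma desc_lb {M t : ℕ} (h : 2 * t ≤ M) : ((M : ℝ) / 2) ^ t ≤ (M.descFactorial t : ℝ) := by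
  have h1 := Nat.pow_sub_le_descFactorial M t
  have h2 : (((M + 1 - t) ^ t : ℕ) : ℝ) ≤ (M.descFactorial t : ℝ) := by exact_mod_cast h1
  refine le_trans ?_ h2
  rw [Nat.cast_pow]
  apply pow_le_pow_left₀ (by positivity)
  rw [Nat.cast_sub (by omega)]
  have : (2 : ℝ) * t ≤ M := by exact_mod_cast h
  push_cast
  linarith

lemma ratio_bound {x D Y F : ℕ} {c d : ℝ} (h : x * D ≤ Y * F) (hd : 0 < d) (hD : d ≤ D)
    (hY : (Y : ℝ) ≤ c * d) : (x : ℝ) ≤ c * F := by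
  have h1 : (x : ℝ) * D ≤ Y * F := by exact_mod_cast h
  have h2 : (x : ℝ) * d ≤ x * D := mul_le_mul_of_nonneg_left hD (Nat.cast_nonneg x)
  have h3 : (Y : ℝ) * F ≤ c * d * F := mul_le_mul_of_nonneg_right hY (Nat.cast_nonneg F)
  have h4 : (x : ℝ) * d ≤ (c * F) * d := by linarith
  exact le_of_mul_le_mul_right h4 hd

lemma tail_bound {r q M m s : ℕ} (hr : 1 ≤ r) (hq : q * r = M) (h40 : 40 * s ≤ M) (hM : 0 < M)
    (hs : 9 * ((r : ℝ) - 1) * m / M ≤ s) (hlog : Real.log M ≤ s) :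
    ((q.choose s * ((r * (r - 1)) ^ s * m ^ s) : ℕ) : ℝ) ≤
      (1 / (M : ℝ)) * ((0.95 : ℝ) * M) ^ (2 * s) := by
  have hM' : (0 : ℝ) < M := by exact_mod_cast hM
  have h1 : ((q.choose s : ℕ) : ℝ) ≤ (q : ℝ) ^ s / (s.factorial : ℝ) :=
    Nat.choose_le_pow_div s q
  have hr' : (1 : ℝ) ≤ r := by exact_mod_cast hr
  have hqr : (q : ℝ) * r = M := by exact_mod_cast hq
  have hfp : (0 : ℝ) < (s.factorial : ℝ) := by exact_mod_cast Nat.factorial_pos s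
  have h2 : ((r : ℝ) - 1) * m ≤ M * s / 9 := by
    rw [div_le_iff₀ hM'] at hs
    linarith
  have h3 : (s : ℝ) ^ s / (s.factorial : ℝ) ≤ Real.exp 1 ^ s := by
    rw [← Real.exp_nat_mul, mul_one]
    exact Real.pow_div_factorial_le_exp (s : ℝ) (Nat.cast_nonneg s) s
  have h4 : Real.exp (-1) ^ s ≤ 1 / (M : ℝ) := by
    rw [← Real.exp_nat_mul, one_div, ← Real.exp_log hM', ← Real.exp_neg]
    apply Real.exp_le_exp.2
    linarith
  have h5 : Real.exp 1 / 9 ≤ Real.exp (-1) * (0.95 : ℝ) ^ 2 := by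
    have he := Real.exp_one_lt_d9
    have hp := Real.exp_pos 1
    rw [Real.exp_neg, ← div_eq_inv_mul, le_div_iff₀ hp]
    nlinarith
  push_cast [Nat.cast_sub hr]
  calc (q.choose s : ℝ) * (((r : ℝ) * ((r : ℝ) - 1)) ^ s * (m : ℝ) ^ s)
      ≤ ((q : ℝ) ^ s / (s.factorial : ℝ)) * (((r : ℝ) * ((r : ℝ) - 1)) ^ s * (m : ℝ) ^ s) := by
        apply mul_le_mul_of_nonneg_right h1
        have : (0 : ℝ) ≤ (r : ℝ) - 1 := by linarith
        positivity
    _ = (M * (((r : ℝ) - 1) * m)) ^ s / (s.factorial : ℝ) := by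
        rw [← hqr, mul_pow, mul_pow, mul_pow, mul_pow]; ring
    _ ≤ (M * (M * s / 9)) ^ s / (s.factorial : ℝ) := by
        have : (0 : ℝ) ≤ (r : ℝ) - 1 := by linarith
        gcongr
    _ = ((M : ℝ) ^ 2) ^ s * (1 / 9) ^ s * ((s : ℝ) ^ s / (s.factorial : ℝ)) := by
        rw [show (M : ℝ) * (M * s / 9) = (M : ℝ) ^ 2 * (1 / 9) * s by ring, mul_pow, mul_pow]; ring
    _ ≤ ((M : ℝ) ^ 2) ^ s * (1 / 9) ^ s * Real.exp 1 ^ s := by gcongr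
    _ = ((M : ℝ) ^ 2) ^ s * (Real.exp 1 / 9) ^ s := by
        rw [mul_assoc, ← mul_pow]; congr 2; ring
    _ ≤ ((M : ℝ) ^ 2) ^ s * (Real.exp (-1) * (0.95 : ℝ) ^ 2) ^ s := by gcongr
    _ = Real.exp (-1) ^ s * ((0.95 : ℝ) * M) ^ (2 * s) := by
        rw [pow_mul ((0.95 : ℝ) * M), mul_pow (0.95 : ℝ) (M : ℝ) 2,
          mul_pow (Real.exp (-1)), mul_pow _ ((M : ℝ) ^ 2)]; ring
    _ ≤ (1 / (M : ℝ)) * ((0.95 : ℝ) * M) ^ (2 * s) := by gcongr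

lemma le_kmax {n : ℕ} (k : Fin n → ℕ) (i : Fin n) : k i ≤ kmax k :=
  Finset.le_sup (f := k) (Finset.mem_univ i)

lemma M2_le {n : ℕ} (k : Fin n → ℕ) : M2 k ≤ Mtot k * kmax k := by
  unfold M2 Mtot
  rw [Finset.sum_mul]
  apply Finset.sum_le_sum
  intro i _
  exact Nat.mul_le_mul_left _ ((Nat.sub_le _ _).trans (le_kmax k i))

lemma cube_le {n : ℕ} (k : Fin n → ℕ) : ∑ i, k i ^ 3 ≤ Mtot k * kmax k ^ 2 := by
  unfold Mtot
  rw [Finset.sum_mul]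
  apply Finset.sum_le_sum
  intro i _
  rw [pow_succ, mul_comm]
  exact Nat.mul_le_mul_left _ (Nat.pow_le_pow_left (le_kmax k i) 2)

lemma N_bound {n r : ℕ} {k : Fin n → ℕ} (hr : 3 ≤ r) (hk : 2 ≤ kmax k)
    (hδ : (kmax k : ℝ) ^ 3 ≤ 1 / (10000 * r) * (Mtot k : ℝ)) :
    40 * (Nbound r k + 1) ≤ Mtot k := by
  have hr' : (3 : ℝ) ≤ r := by exact_mod_cast hr
  have hk' : (2 : ℝ) ≤ kmax k := by exact_mod_cast hk
  have h1 : (kmax k : ℝ) ^ 3 * (10000 * r) ≤ Mtot k := by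
    rw [one_div, ← div_eq_inv_mul, le_div_iff₀ (by positivity)] at hδ
    exact hδ
  have hK4 : 4 * (kmax k : ℝ) ≤ (kmax k : ℝ) ^ 3 := by
    nlinarith [mul_nonneg (by linarith : (0 : ℝ) ≤ (kmax k : ℝ)) (by nlinarith : (0 : ℝ) ≤ (kmax k : ℝ) ^ 2 - 4)]
  have h2 : 40000 * (r * (kmax k : ℝ)) ≤ Mtot k := by nlinarith
  have h3 : (240000 : ℝ) ≤ Mtot k := by nlinarith
  have hM : (0 : ℝ) < Mtot k := by linarith
  have hs : (Nbound r k : ℝ) ≤ (Mtot k : ℝ) / 40 - 1 := by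
    unfold Nbound
    rw [Nat.cast_max]
    apply max_le
    · have hl : Real.log (Mtot k) ≤ 2 * Real.sqrt (Mtot k) := by
        have h4 : Real.log (Mtot k) = 2 * Real.log (Real.sqrt (Mtot k)) := by
          rw [Real.log_sqrt hM.le]; ring
        rw [h4]
        have := Real.log_le_self (Real.sqrt_nonneg (Mtot k : ℝ))
        linarith
      have hsq := Real.mul_self_sqrt hM.le
      have h400 : (400 : ℝ) ≤ Real.sqrt (Mtot k) := by
        apply Real.le_sqrt_of_sq_le; linarith
      have h0 : 0 ≤ Real.log (Mtot k) := Real.log_nonneg (by linarith)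
      have := Nat.ceil_lt_add_one h0
      nlinarith
    · have hm : (M2 k : ℝ) ≤ Mtot k * kmax k := by exact_mod_cast M2_le k
      have h0 : 0 ≤ 9 * ((r : ℝ) - 1) * (M2 k : ℝ) / (Mtot k : ℝ) := by
        have : (0 : ℝ) ≤ (r : ℝ) - 1 := by linarith
        positivity
      have h5 : 9 * ((r : ℝ) - 1) * (M2 k : ℝ) / (Mtot k : ℝ) ≤ 9 * (r * (kmax k : ℝ)) := by
        rw [div_le_iff₀ hM]
        have h6 : ((r : ℝ) - 1) * (M2 k : ℝ) ≤ r * (Mtot k * kmax k) := by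
          apply mul_le_mul (by linarith) hm (by positivity) (by linarith)
        linarith
      have := Nat.ceil_lt_add_one h0
      nlinarith
  have : (40 : ℝ) * ((Nbound r k : ℝ) + 1) ≤ Mtot k := by linarith
  exact_mod_cast this

lemma not_plus_events {n r : ℕ} {k : Fin n → ℕ} {Q : Finset (Finset (Pts k))}
    (hQ : IsPartition r k Q) (g : Equiv.Perm (Pts k)) (h : actQ g Q ∉ LamPlus r k) :
    (∃ U ∈ Q, ∃ i, 3 ≤ mult (U.map g.toEmbedding) i) ∨
    (∃ U ∈ Q, ∃ i j, i ≠ j ∧ mult (U.map g.toEmbedding) i = 2 ∧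
        mult (U.map g.toEmbedding) j = 2) ∨
    (∃ U ∈ Q, ∃ W ∈ Q, U ≠ W ∧
        3 ≤ (vset (U.map g.toEmbedding) ∩ vset (W.map g.toEmbedding)).card) ∨
    Nbound r k + 1 ≤ nloops (actQ g Q) := by
  by_contra hcon
  simp only [not_or] at hcon
  obtain ⟨h1, h2, h3, h4⟩ := hcon
  apply h
  refine ⟨actQ_partition g hQ, ?_, ?_, ?_, by omega⟩
  · intro V hV i
    obtain ⟨U, hU, rfl⟩ := (mem_actQ g Q V).1 hV
    by_contra hc
    exact h1 ⟨U, hU, i, by omega⟩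
  · intro V hV i j hi hj
    obtain ⟨U, hU, rfl⟩ := (mem_actQ g Q V).1 hV
    by_contra hc
    exact h2 ⟨U, hU, i, j, hc, hi, hj⟩
  · intro V hV X hX hVX
    obtain ⟨U, hU, rfl⟩ := (mem_actQ g Q V).1 hV
    obtain ⟨W, hW, rfl⟩ := (mem_actQ g Q X).1 hX
    by_contra hc
    exact h3 ⟨U, hU, W, hW, fun hUW => hVX (by rw [hUW]), by omega⟩

lemma main_count {n r : ℕ} {k : Fin n → ℕ} (hr : 3 ≤ r) (hk : 2 ≤ kmax k)
    (hδ : (kmax k : ℝ) ^ 3 ≤ 1 / (10000 * r) * (Mtot k : ℝ))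
    (Bad : Finset (Finset (Finset (Pts k)))) (hBad : ∀ Q ∈ Bad, Q ∉ LamPlus r k)
    (Q : Finset (Finset (Pts k))) (hQ : IsPartition r k Q) :
    ((Finset.univ.filter fun g : Equiv.Perm (Pts k) => actQ g Q ∈ Bad).card : ℝ) ≤
      (8 * r ^ 3 + 16 * r ^ 4 + 64 * r ^ 6 + 1) * (kmax k : ℝ) ^ 3 / (Mtot k : ℝ) *
        (Fintype.card (Pts k)).factorial := by
  have hN := N_bound hr hk hδ
  have hr' : (3 : ℝ) ≤ r := by exact_mod_cast hr
  have hk' : (2 : ℝ) ≤ kmax k := by exact_mod_cast hk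
  have h240 : (240000 : ℝ) ≤ Mtot k := by
    rw [one_div, ← div_eq_inv_mul, le_div_iff₀ (by positivity)] at hδ
    have : (8 : ℝ) ≤ (kmax k : ℝ) ^ 3 := by
      calc (8 : ℝ) = 2 ^ 3 := by norm_num
        _ ≤ _ := by gcongr
    nlinarith
  have hMn : 240000 ≤ Mtot k := by exact_mod_cast h240
  have hM : (0 : ℝ) < Mtot k := by linarith
  have hqr := partition_card hQ
  have hqM : (Q.card : ℝ) ≤ Mtot k := by
    have : Q.card ≤ Mtot k := by nlinarith
    exact_mod_cast this
  have hm : (M2 k : ℝ) ≤ Mtot k * kmax k := by exact_mod_cast M2_le k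
  have hc : ((∑ i, k i ^ 3 : ℕ) : ℝ) ≤ Mtot k * (kmax k : ℝ) ^ 2 := by exact_mod_cast cube_le k
  rw [card_Pts]
  have hK1 : (1 : ℝ) ≤ kmax k := by linarith
  have hK23 : (kmax k : ℝ) ^ 2 ≤ (kmax k : ℝ) ^ 3 := pow_le_pow_right₀ hK1 (by norm_num)
  have b1 := ratio_bound (c := 8 * r ^ 3 * (kmax k : ℝ) ^ 3 / (Mtot k : ℝ)) (event1 hQ)
    (by positivity) (desc_lb (by omega)) (by
      push_cast at hc ⊢
      calc (Q.card : ℝ) * r ^ 3 * ∑ i, (k i : ℝ) ^ 3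
          ≤ Mtot k * r ^ 3 * (Mtot k * (kmax k : ℝ) ^ 2) := by gcongr
        _ ≤ Mtot k * r ^ 3 * (Mtot k * (kmax k : ℝ) ^ 3) := by gcongr
        _ = _ := by field_simp; norm_num)
  have b2 := ratio_bound (c := 16 * r ^ 4 * (kmax k : ℝ) ^ 3 / (Mtot k : ℝ)) (event2 hQ)
    (by positivity) (desc_lb (by omega)) (by
      push_cast
      calc (Q.card : ℝ) * ((r : ℝ) * r) ^ 2 * (M2 k : ℝ) ^ 2
          ≤ Mtot k * ((r : ℝ) * r) ^ 2 * (Mtot k * kmax k) ^ 2 := by gcongr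
        _ = Mtot k * ((r : ℝ) * r) ^ 2 * ((Mtot k : ℝ) ^ 2 * (kmax k : ℝ) ^ 2) := by ring
        _ ≤ Mtot k * ((r : ℝ) * r) ^ 2 * ((Mtot k : ℝ) ^ 2 * (kmax k : ℝ) ^ 3) := by gcongr
        _ = _ := by field_simp; norm_num)
  have b3 := ratio_bound (c := 64 * r ^ 6 * (kmax k : ℝ) ^ 3 / (Mtot k : ℝ)) (event3 hQ)
    (by positivity) (desc_lb (by omega)) (by
      push_cast
      calc (Q.card : ℝ) ^ 2 * ((r : ℝ) * r) ^ 3 * (M2 k : ℝ) ^ 3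
          ≤ (Mtot k : ℝ) ^ 2 * ((r : ℝ) * r) ^ 3 * (Mtot k * kmax k) ^ 3 := by gcongr
        _ = _ := by field_simp; norm_num)
  have h4 := event4 (s := Nbound r k + 1) hQ
  rw [← mul_assoc] at h4
  have b4 := ratio_bound (c := 1 / (Mtot k : ℝ)) (d := ((0.95 : ℝ) * Mtot k) ^ (2 * (Nbound r k + 1)))
    h4 (by positivity) (by
      have h1 := Nat.pow_sub_le_descFactorial (Mtot k) (2 * (Nbound r k + 1))
      have h2 : (((Mtot k + 1 - 2 * (Nbound r k + 1)) ^ (2 * (Nbound r k + 1)) : ℕ) : ℝ) ≤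
        ((Mtot k).descFactorial (2 * (Nbound r k + 1)) : ℝ) := by exact_mod_cast h1
      refine le_trans ?_ h2
      rw [Nat.cast_pow]
      apply pow_le_pow_left₀ (by positivity)
      rw [Nat.cast_sub (by omega)]
      have : (40 : ℝ) * (Nbound r k + 1) ≤ Mtot k := by exact_mod_cast hN
      push_cast
      linarith)
    (tail_bound (by omega) hqr hN (by omega) (by
      push_cast
      have := (Nat.le_ceil (9 * ((r : ℝ) - 1) * (M2 k : ℝ) / (Mtot k : ℝ))).trans
        (Nat.cast_le.2 (le_max_right ⌈Real.log (Mtot k)⌉₊ _))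
      unfold Nbound
      linarith) (by
      push_cast
      have := (Nat.le_ceil (Real.log (Mtot k))).trans
        (Nat.cast_le.2 (le_max_left _ ⌈9 * ((r : ℝ) - 1) * (M2 k : ℝ) / (Mtot k : ℝ)⌉₊))
      unfold Nbound
      linarith))
  have hsub : (Finset.univ.filter fun g : Equiv.Perm (Pts k) => actQ g Q ∈ Bad) ⊆
      (Finset.univ.filter fun g : Equiv.Perm (Pts k) =>
        ∃ U ∈ Q, ∃ i, 3 ≤ mult (U.map g.toEmbedding) i) ∪
      ((Finset.univ.filter fun g : Equiv.Perm (Pts k) =>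
        ∃ U ∈ Q, ∃ i j, i ≠ j ∧ mult (U.map g.toEmbedding) i = 2 ∧
          mult (U.map g.toEmbedding) j = 2) ∪
      ((Finset.univ.filter fun g : Equiv.Perm (Pts k) =>
        ∃ U ∈ Q, ∃ W ∈ Q, U ≠ W ∧
          3 ≤ (vset (U.map g.toEmbedding) ∩ vset (W.map g.toEmbedding)).card) ∪
      (Finset.univ.filter fun g : Equiv.Perm (Pts k) =>
        Nbound r k + 1 ≤ nloops (actQ g Q)))) := by
    intro g hg
    have h := not_plus_events hQ g (hBad _ (Finset.mem_filter.1 hg).2)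
    simp only [Finset.mem_union, Finset.mem_filter, Finset.mem_univ, true_and]
    exact h
  have hcard := (Finset.card_le_card hsub).trans ((Finset.card_union_le _ _).trans
    (Nat.add_le_add_left ((Finset.card_union_le _ _).trans
      (Nat.add_le_add_left (Finset.card_union_le _ _) _)) _))
  have hcard' := (Nat.cast_le (α := ℝ)).2 hcard
  push_cast at hcard'
  have b5 : 1 / (Mtot k : ℝ) * (Mtot k).factorial ≤
      (kmax k : ℝ) ^ 3 / (Mtot k : ℝ) * (Mtot k).factorial := by
    gcongr
    exact one_le_pow₀ hK1
  refine hcard'.trans ?_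
  have e : (8 * (r : ℝ) ^ 3 + 16 * r ^ 4 + 64 * r ^ 6 + 1) * (kmax k : ℝ) ^ 3 / (Mtot k : ℝ) *
        ((Mtot k).factorial : ℝ) = 8 * r ^ 3 * (kmax k : ℝ) ^ 3 / (Mtot k : ℝ) * (Mtot k).factorial
      + 16 * r ^ 4 * (kmax k : ℝ) ^ 3 / (Mtot k : ℝ) * (Mtot k).factorial
      + 64 * r ^ 6 * (kmax k : ℝ) ^ 3 / (Mtot k : ℝ) * (Mtot k).factorial
      + (kmax k : ℝ) ^ 3 / (Mtot k : ℝ) * (Mtot k).factorial := by ring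
  rw [e]
  linarith

end Aux

/-- almost all partitions lie in `Λ_r⁺(k)` (Lemma 2 of the paper). -/
theorem lamPlus_ratio (r : ℕ) (hr : 3 ≤ r) :
    ∃ C δ : ℝ, 0 < C ∧ 0 < δ ∧
      ∀ (n : ℕ) (k : Fin n → ℕ),
        r ∣ Mtot k → 2 ≤ kmax k → (kmax k : ℝ) ^ 3 ≤ δ * (Mtot k : ℝ) →
        ∃ E : ℝ, |E| ≤ C * (kmax k : ℝ) ^ 3 / (Mtot k : ℝ) ∧
          (Set.ncard (LamPlus r k) : ℝ) / (Set.ncard (Lam r k) : ℝ) = 1 + E := by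
  have hr0 : (0 : ℝ) < r := by
    have : 0 < r := by omega
    exact_mod_cast this
  refine ⟨8 * r ^ 3 + 16 * r ^ 4 + 64 * r ^ 6 + 1, 1 / (10000 * r), by positivity,
    by positivity, ?_⟩
  intro n k hd hk hδ
  let Plus : Finset (Finset (Finset (Pts k))) := (LamFinset r k).filter fun Q => Q ∈ LamPlus r k
  let Bad : Finset (Finset (Finset (Pts k))) := (LamFinset r k).filter fun Q => Q ∉ LamPlus r k
  have hL : Lam r k = (LamFinset r k : Set (Finset (Finset (Pts k)))) := by
    ext Q; simp [Lam, LamFinset]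
  have hP : LamPlus r k = (Plus : Set (Finset (Finset (Pts k)))) := by
    ext Q
    simp only [Plus, Finset.coe_filter, Set.mem_ofPred_eq]
    refine ⟨fun h => ⟨?_, h⟩, fun h => h.2⟩
    simp only [LamFinset, Finset.mem_filter, Finset.mem_univ, true_and]
    exact h.1
  have hb := aux_average Bad (Finset.filter_subset _ _) _
    (main_count hr hk hδ Bad (fun Q hQ => (Finset.mem_filter.1 hQ).2))
  have hsum : Plus.card + Bad.card = (LamFinset r k).card :=
    Finset.card_filter_add_card_filter_not _
  have hsum' : (Plus.card : ℝ) + Bad.card = (LamFinset r k).card := by exact_mod_cast hsum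
  have hpos : (0 : ℝ) < (LamFinset r k).card := by
    exact_mod_cast Finset.card_pos.2 (Lam_nonempty hd)
  rw [hL, hP, Set.ncard_coe_finset, Set.ncard_coe_finset]
  generalize Plus.card = p at *
  generalize Bad.card = b at *
  generalize (LamFinset r k).card = l at *
  refine ⟨-((b : ℝ) / l), ?_, ?_⟩
  · rw [abs_neg, abs_of_nonneg (by positivity), div_le_iff₀ hpos]
    exact hb
  · rw [← hsum'] at hpos ⊢
    field_simp
    ring
end

section
/- Let Q ∈ C_ℓ and let (x_1,x_2,y_1,y_2) specify an ℓ-switching in Q with parts U, W_1, W_2 and corresponding edges e, f_1, f_2 of G(Q). If the ℓ-switching is illegal for Q (i.e. the resulting partition Q' does not lie in C_{ℓ−1}), then at least one of the following holds: (I) at least one of W_1, W_2 contains a loop; (II) e, f_1 and f_2 are not pairwise disjoint (as vertex sets); (III) some edge of G(Q) other than e, f_1, f_2 intersects both e and f_j for some j ∈ {1,2}. -/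
open scoped Classical BigOperators

theorem mult_le_one_of_not_hasLoop {n : ℕ} {k : Fin n → ℕ} {U : Finset (Pts k)}
    (h : ¬ HasLoop U) (i : Fin n) : mult U i ≤ 1 := by
  unfold mult
  rw [Finset.card_le_one]
  intro a ha b hb
  simp only [Finset.mem_filter] at ha hb
  by_contra hab
  exact h ⟨a, ha.1, b, hb.1, hab, by rw [ha.2, hb.2]⟩

theorem two_le_mult {n : ℕ} {k : Fin n → ℕ} {U : Finset (Pts k)} {a b : Pts k}
    (ha : a ∈ U) (hb : b ∈ U) (hab : a ≠ b) (h : a.1 = b.1) : 2 ≤ mult U a.1 := by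
  unfold mult
  rw [← Finset.card_pair hab]
  apply Finset.card_le_card
  intro p hp
  simp only [Finset.mem_insert, Finset.mem_singleton] at hp
  rcases hp with rfl | rfl <;> simp [*]

theorem three_le_mult {n : ℕ} {k : Fin n → ℕ} {U : Finset (Pts k)} {a b c : Pts k}
    (ha : a ∈ U) (hb : b ∈ U) (hc : c ∈ U) (hab : a ≠ b) (hac : a ≠ c) (hbc : b ≠ c)
    (h : a.1 = b.1) (h' : a.1 = c.1) : 3 ≤ mult U a.1 := by
  unfold mult
  have h3 : ({a, b, c} : Finset (Pts k)).card = 3 := Finset.card_eq_three.mpr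
    ⟨a, b, c, hab, hac, hbc, rfl⟩
  rw [← h3]
  apply Finset.card_le_card
  intro p hp
  simp only [Finset.mem_insert, Finset.mem_singleton] at hp
  rw [Finset.mem_filter]
  rcases hp with rfl | rfl | rfl
  · exact ⟨ha, rfl⟩
  · exact ⟨hb, h.symm⟩
  · exact ⟨hc, h'.symm⟩

theorem mem_vset_iff {n : ℕ} {k : Fin n → ℕ} {U : Finset (Pts k)} {i : Fin n} :
    i ∈ vset U ↔ ∃ p ∈ U, p.1 = i := by
  simp [vset]

set_option maxHeartbeats 2000000 in
/-- if an ℓ-switching is illegal then condition (I), (II) or (III)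
holds (Lemma 3 of the paper). -/
theorem illegal_forward_switching (r : ℕ) (hr : 3 ≤ r) {n : ℕ} (k : Fin n → ℕ)
    (ℓ : ℕ) (hℓ : 1 ≤ ℓ) (Q : Finset (Finset (Pts k))) (hQ : Q ∈ Cset r k ℓ)
    (U W₁ W₂ : Finset (Pts k)) (x₁ x₂ y₁ y₂ : Pts k)
    (hsw : IsSwitching Q U W₁ W₂ x₁ x₂ y₁ y₂)
    (hillegal : switchResult Q U W₁ W₂ x₁ x₂ y₁ y₂ ∉ Cset r k (ℓ - 1)) :
    (HasLoop W₁ ∨ HasLoop W₂) ∨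
      ¬(Disjoint (vset U) (vset W₁) ∧ Disjoint (vset U) (vset W₂) ∧
          Disjoint (vset W₁) (vset W₂)) ∨
      ∃ W ∈ Q, W ≠ U ∧ W ≠ W₁ ∧ W ≠ W₂ ∧ (vset W ∩ vset U).Nonempty ∧
        ((vset W ∩ vset W₁).Nonempty ∨ (vset W ∩ vset W₂).Nonempty) := by
  by_contra hcon
  rw [not_or, not_or, not_or, not_not] at hcon
  obtain ⟨⟨hL1, hL2⟩, ⟨hd1, hd2, hd3⟩, hIII⟩ := hcon
  simp only [not_exists, not_and, not_or] at hIII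
  apply hillegal
  obtain ⟨hU, hW1, hW2, hUW1, hUW2, hWW, hx1, hx2, hxx, hxc, hy1, hy2, hyc⟩ := hsw
  obtain ⟨⟨⟨hcard, hpart⟩, hi, hii, hiii, hiv⟩, hl⟩ := hQ
  have huniq : ∀ p, ∀ V ∈ Q, ∀ V' ∈ Q, p ∈ V → p ∈ V' → V = V' :=
    fun p V hV V' hV' h h' => (hpart p).unique ⟨hV, h⟩ ⟨hV', h'⟩
  have hex : ∀ p, ∃ V ∈ Q, p ∈ V := fun p => by
    obtain ⟨V, ⟨h1, h2⟩, -⟩ := hpart p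
    exact ⟨V, h1, h2⟩
  have hIII' : ∀ W ∈ Q, W ≠ U → W ≠ W₁ → W ≠ W₂ → ∀ i ∈ vset W, i ∈ vset U →
      ∀ j ∈ vset W, j ∉ vset W₁ ∧ j ∉ vset W₂ := by
    intro W hW h1 h2 h3 i hi1 hi2 j hj
    have := hIII W hW h1 h2 h3 ⟨i, Finset.mem_inter.mpr ⟨hi1, hi2⟩⟩
    exact ⟨fun h => this.1 ⟨j, Finset.mem_inter.mpr ⟨hj, h⟩⟩,
      fun h => this.2 ⟨j, Finset.mem_inter.mpr ⟨hj, h⟩⟩⟩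
  rw [Finset.disjoint_left] at hd1 hd2 hd3
  have hv : ∀ {V : Finset (Pts k)} {p : Pts k}, p ∈ V → p.1 ∈ vset V :=
    fun h => mem_vset_iff.mpr ⟨_, h, rfl⟩
  have hmx : mult U x₁.1 = 2 := le_antisymm (hi U hU _) (two_le_mult hx1 hx2 hxx hxc)
  -- the new parts
  obtain ⟨A, hA⟩ : ∃ A, A = (U \ {x₁, x₂}) ∪ {y₁, y₂} := ⟨_, rfl⟩
  obtain ⟨B, hB⟩ : ∃ B, B = (W₁ \ {y₁}) ∪ {x₁} := ⟨_, rfl⟩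
  obtain ⟨C, hC⟩ : ∃ C, C = (W₂ \ {y₂}) ∪ {x₂} := ⟨_, rfl⟩
  have mA : ∀ p, p ∈ A ↔ (p ∈ U ∧ p ≠ x₁ ∧ p ≠ x₂) ∨ p = y₁ ∨ p = y₂ := by
    intro p; simp [hA]; tauto
  have mB : ∀ p, p ∈ B ↔ (p ∈ W₁ ∧ p ≠ y₁) ∨ p = x₁ := by
    intro p; simp [hB, or_comm]
  have mC : ∀ p, p ∈ C ↔ (p ∈ W₂ ∧ p ≠ y₂) ∨ p = x₂ := by
    intro p; simp [hC, or_comm]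
  have hyy : y₁ ≠ y₂ := fun h => hyc (by rw [h])
  have ny1U : y₁ ∉ U := fun h => hUW1 (huniq _ _ hU _ hW1 h hy1)
  have ny2U : y₂ ∉ U := fun h => hUW2 (huniq _ _ hU _ hW2 h hy2)
  have nx1 : x₁ ∉ W₁ := fun h => hUW1 (huniq _ _ hU _ hW1 hx1 h)
  have nx2 : x₂ ∉ W₂ := fun h => hUW2 (huniq _ _ hU _ hW2 hx2 h)
  have hQ' : ∀ V, V ∈ switchResult Q U W₁ W₂ x₁ x₂ y₁ y₂ ↔
      (V ∈ Q ∧ V ≠ U ∧ V ≠ W₁ ∧ V ≠ W₂) ∨ V = A ∨ V = B ∨ V = C := by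
    intro V
    unfold switchResult
    rw [← hA, ← hB, ← hC]
    simp only [Finset.mem_union, Finset.mem_sdiff, Finset.mem_insert, Finset.mem_singleton,
      not_or]
  -- loop-freeness
  have lA : ¬ HasLoop A := by
    rintro ⟨a, ha, b, hb, hab, hc⟩
    rw [mA] at ha hb
    have key : ∀ p ∈ U, p.1 ≠ y₁.1 ∧ p.1 ≠ y₂.1 := fun p hp =>
      ⟨fun h => hd1 (hv hp) (h ▸ hv hy1), fun h => hd2 (hv hp) (h ▸ hv hy2)⟩
    rcases ha with ⟨ha, ha1, ha2⟩ | ha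
    · rcases hb with ⟨hb, hb1, hb2⟩ | hb
      · have h2 : mult U a.1 = 2 := le_antisymm (hi U hU _) (two_le_mult ha hb hab hc)
        have h3 := hii U hU _ _ h2 hmx
        have := three_le_mult ha hx1 hx2 ha1 ha2 hxx h3 (h3.trans hxc)
        omega
      · rcases hb with rfl | rfl
        · exact (key a ha).1 hc
        · exact (key a ha).2 hc
    · rcases hb with ⟨hb, hb1, hb2⟩ | hb
      · rcases ha with rfl | rfl
        · exact (key b hb).1 hc.symm
        · exact (key b hb).2 hc.symm
      · rcases ha with rfl | rfl <;> rcases hb with rfl | rfl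
        · exact hab rfl
        · exact hyc hc
        · exact hyc hc.symm
        · exact hab rfl
  have lBC : ∀ (W D : Finset (Pts k)) (x y : Pts k), ¬ HasLoop W →
      (∀ ⦃i⦄, i ∈ vset U → i ∉ vset W) → x ∈ U →
      (∀ p, p ∈ D ↔ (p ∈ W ∧ p ≠ y) ∨ p = x) → ¬ HasLoop D := by
    rintro W D x y hW hd hx hD ⟨a, ha, b, hb, hab, hc⟩
    rw [hD] at ha hb
    rcases ha with ⟨ha, -⟩ | rfl <;> rcases hb with ⟨hb, -⟩ | rfl
    · exact hW ⟨a, ha, b, hb, hab, hc⟩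
    · exact hd (hv hx) (hc ▸ hv ha)
    · exact hd (hv hx) (hc ▸ hv hb)
    · exact hab rfl
  have lB : ¬ HasLoop B := lBC W₁ B x₁ y₁ hL1 hd1 hx1 mB
  have lC : ¬ HasLoop C := lBC W₂ C x₂ y₂ hL2 hd2 hx2 mC
  have lU : HasLoop U := ⟨x₁, hx1, x₂, hx2, hxx, hxc⟩
  -- vertex sets
  have vA : ∀ i ∈ vset A, i ∈ vset U ∨ i = y₁.1 ∨ i = y₂.1 := by
    intro i h
    obtain ⟨p, hp, rfl⟩ := mem_vset_iff.mp h
    rcases (mA p).mp hp with h | rfl | rfl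
    · exact Or.inl (hv h.1)
    · simp
    · simp
  have vB : ∀ i ∈ vset B, i ∈ vset W₁ ∨ i = x₁.1 := by
    intro i h
    obtain ⟨p, hp, rfl⟩ := mem_vset_iff.mp h
    rcases (mB p).mp hp with h | rfl
    · exact Or.inl (hv h.1)
    · simp
  have vC : ∀ i ∈ vset C, i ∈ vset W₂ ∨ i = x₁.1 := by
    intro i h
    obtain ⟨p, hp, rfl⟩ := mem_vset_iff.mp h
    rcases (mC p).mp hp with h | rfl
    · exact Or.inl (hv h.1)
    · simp [hxc]
  have vx : x₁.1 ∈ vset U := hv hx1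
  have vy1 : y₁.1 ∈ vset W₁ := hv hy1
  have vy2 : y₂.1 ∈ vset W₂ := hv hy2
  have pair : ∀ (S : Finset (Fin n)) (a b : Fin n), (∀ i ∈ S, i = a ∨ i = b) → S.card ≤ 2 := by
    intro S a b h
    refine (Finset.card_le_card (t := {a, b}) ?_).trans Finset.card_le_two
    intro i hi
    simpa using h i hi
  have oA : ∀ W ∈ Q, W ≠ U → W ≠ W₁ → W ≠ W₂ → (vset A ∩ vset W).card ≤ 2 := by
    intro W hW h1 h2 h3
    by_cases hm : ∃ i ∈ vset W, i ∈ vset U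
    · obtain ⟨i, hi1, hi2⟩ := hm
      refine (Finset.card_le_card ?_).trans (hiii U hU W hW h1.symm)
      intro j hj
      rw [Finset.mem_inter] at hj ⊢
      have := hIII' W hW h1 h2 h3 i hi1 hi2 j hj.2
      rcases vA j hj.1 with h | rfl | rfl
      · exact ⟨h, hj.2⟩
      · exact absurd vy1 this.1
      · exact absurd vy2 this.2
    · apply pair _ y₁.1 y₂.1
      intro j hj
      rw [Finset.mem_inter] at hj
      exact (vA j hj.1).resolve_left fun h => hm ⟨j, hj.2, h⟩
  have oBC : ∀ V ∈ Q, (∀ i ∈ vset V, i ∈ vset W₁ ∨ i ∈ vset W₂) → ∀ D : Finset (Pts k),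
      (∀ i ∈ vset D, i ∈ vset V ∨ i = x₁.1) →
      ∀ W ∈ Q, W ≠ V → W ≠ U → W ≠ W₁ → W ≠ W₂ → (vset D ∩ vset W).card ≤ 2 := by
    intro V hV hVW D hD W hW h0 h1 h2 h3
    by_cases hm : ∃ i ∈ vset W, i ∈ vset V
    · obtain ⟨i, hi1, hi2⟩ := hm
      refine (Finset.card_le_card ?_).trans (hiii V hV W hW h0.symm)
      intro j hj
      rw [Finset.mem_inter] at hj ⊢
      rcases hD j hj.1 with h | rfl
      · exact ⟨h, hj.2⟩
      · have := hIII' W hW h1 h2 h3 _ hj.2 vx i hi1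
        rcases hVW i hi2 with h | h
        · exact absurd h this.1
        · exact absurd h this.2
    · apply pair _ x₁.1 x₁.1
      intro j hj
      rw [Finset.mem_inter] at hj
      exact Or.inl ((hD j hj.1).resolve_left fun h => hm ⟨j, hj.2, h⟩)
  have oB : ∀ W ∈ Q, W ≠ U → W ≠ W₁ → W ≠ W₂ → (vset B ∩ vset W).card ≤ 2 :=
    fun W hW h1 h2 h3 => oBC W₁ hW1 (fun _ h => Or.inl h) B vB W hW h2 h1 h2 h3
  have oC : ∀ W ∈ Q, W ≠ U → W ≠ W₁ → W ≠ W₂ → (vset C ∩ vset W).card ≤ 2 :=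
    fun W hW h1 h2 h3 => oBC W₂ hW2 (fun _ h => Or.inr h) C vC W hW h3 h1 h2 h3
  have oAB : (vset A ∩ vset B).card ≤ 2 := by
    apply pair _ y₁.1 x₁.1
    intro j hj
    rw [Finset.mem_inter] at hj
    rcases vA j hj.1 with h | h | h <;> rcases vB j hj.2 with h' | h' <;> grind
  have oAC : (vset A ∩ vset C).card ≤ 2 := by
    apply pair _ y₂.1 x₁.1
    intro j hj
    rw [Finset.mem_inter] at hj
    rcases vA j hj.1 with h | h | h <;> rcases vC j hj.2 with h' | h' <;> grind
  have oBC' : (vset B ∩ vset C).card ≤ 2 := by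
    apply pair _ x₁.1 x₁.1
    intro j hj
    rw [Finset.mem_inter] at hj
    rcases vB j hj.1 with h | h <;> rcases vC j hj.2 with h' | h' <;> grind
  -- number of loops
  have hn : nloops (switchResult Q U W₁ W₂ x₁ x₂ y₁ y₂) = ℓ - 1 := by
    have : (switchResult Q U W₁ W₂ x₁ x₂ y₁ y₂).filter (fun V => HasLoop V) =
        (Q.filter fun V => HasLoop V).erase U := by
      ext V
      rw [Finset.mem_filter, hQ', Finset.mem_erase, Finset.mem_filter]
      constructor
      · rintro ⟨h | rfl | rfl | rfl, h'⟩
        · exact ⟨h.2.1, h.1, h'⟩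
        · exact absurd h' lA
        · exact absurd h' lB
        · exact absurd h' lC
      · rintro ⟨h1, h2, h3⟩
        exact ⟨Or.inl ⟨h2, h1, fun h => hL1 (h ▸ h3), fun h => hL2 (h ▸ h3)⟩, h3⟩
    unfold nloops at hl ⊢
    rw [this, Finset.card_erase_of_mem (Finset.mem_filter.mpr ⟨hU, lU⟩), hl]
  -- partition
  have cA : A.card = r := by
    have h1 : ({x₁, x₂} : Finset (Pts k)) ⊆ U := by
      intro p hp
      simp only [Finset.mem_insert, Finset.mem_singleton] at hp
      rcases hp with rfl | rfl <;> assumption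
    have h2 : Disjoint (U \ {x₁, x₂}) ({y₁, y₂} : Finset (Pts k)) := by
      rw [Finset.disjoint_right]
      intro p hp
      simp only [Finset.mem_insert, Finset.mem_singleton] at hp
      rcases hp with rfl | rfl <;> simp [*]
    rw [hA, Finset.card_union_of_disjoint h2, Finset.card_sdiff_of_subset h1,
      Finset.card_pair hxx, Finset.card_pair hyy, hcard U hU]
    omega
  have cBC : ∀ (W : Finset (Pts k)) (x y : Pts k), W ∈ Q → y ∈ W → x ∉ W →
      ((W \ {y}) ∪ {x}).card = r := by
    intro W x y hW hy hx
    have h1 : ({y} : Finset (Pts k)) ⊆ W := by simpa using hy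
    have h2 : Disjoint (W \ {y}) ({x} : Finset (Pts k)) := by simp [hx]
    rw [Finset.card_union_of_disjoint h2, Finset.card_sdiff_of_subset h1,
      Finset.card_singleton, Finset.card_singleton, hcard W hW]
    omega
  have cB : B.card = r := hB ▸ cBC W₁ x₁ y₁ hW1 hy1 nx1
  have cC : C.card = r := hC ▸ cBC W₂ x₂ y₂ hW2 hy2 nx2
  have hP : IsPartition r k (switchResult Q U W₁ W₂ x₁ x₂ y₁ y₂) := by
    refine ⟨?_, ?_⟩
    · intro V hV
      rcases (hQ' V).mp hV with h | rfl | rfl | rfl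
      · exact hcard V h.1
      all_goals assumption
    · intro p
      obtain ⟨V, hV, hpV⟩ := hex p
      have hVu : ∀ V' ∈ Q, p ∈ V' → V' = V := fun V' h h' => huniq p V' h V hV h' hpV
      have eA : (p ∈ A) ↔ (V = U ∧ p ≠ x₁ ∧ p ≠ x₂) ∨ p = y₁ ∨ p = y₂ := by
        rw [mA]; clear * - hVu hV hpV hU hW1 hW2; grind
      have eB : (p ∈ B) ↔ (V = W₁ ∧ p ≠ y₁) ∨ p = x₁ := by
        rw [mB]; clear * - hVu hV hpV hU hW1 hW2; grind
      have eC : (p ∈ C) ↔ (V = W₂ ∧ p ≠ y₂) ∨ p = x₂ := by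
        rw [mC]; clear * - hVu hV hpV hU hW1 hW2; grind
      have f1 : p = x₁ → V = U := fun h => (hVu U hU (h ▸ hx1)).symm
      have f2 : p = x₂ → V = U := fun h => (hVu U hU (h ▸ hx2)).symm
      have f3 : p = y₁ → V = W₁ := fun h => (hVu W₁ hW1 (h ▸ hy1)).symm
      have f4 : p = y₂ → V = W₂ := fun h => (hVu W₂ hW2 (h ▸ hy2)).symm
      apply existsUnique_of_exists_of_unique
      · by_cases hA' : p ∈ A
        · exact ⟨A, (hQ' A).mpr (by simp), hA'⟩
        by_cases hB' : p ∈ B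
        · exact ⟨B, (hQ' B).mpr (by simp), hB'⟩
        by_cases hC' : p ∈ C
        · exact ⟨C, (hQ' C).mpr (by simp), hC'⟩
        refine ⟨V, (hQ' V).mpr (Or.inl ⟨hV, ?_⟩), hpV⟩
        rw [eA] at hA'
        rw [eB] at hB'
        rw [eC] at hC'
        clear * - hA' hB' hC'
        tauto
      · have nAB : ¬ (p ∈ A ∧ p ∈ B) := by rw [eA, eB]; clear * - f1 f2 f3 f4 hUW1 hUW2 hWW hxx hyy; grind
        have nAC : ¬ (p ∈ A ∧ p ∈ C) := by rw [eA, eC]; clear * - f1 f2 f3 f4 hUW1 hUW2 hWW hxx hyy; grind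
        have nBC : ¬ (p ∈ B ∧ p ∈ C) := by rw [eB, eC]; clear * - f1 f2 f3 f4 hUW1 hUW2 hWW hxx hyy; grind
        have nold : V ≠ U → V ≠ W₁ → V ≠ W₂ → p ∉ A ∧ p ∉ B ∧ p ∉ C := by
          rw [eA, eB, eC]
          clear * - f1 f2 f3 f4
          tauto
        have nold' : ∀ V', (V' ∈ Q ∧ V' ≠ U ∧ V' ≠ W₁ ∧ V' ≠ W₂) → p ∈ V' →
            V' = V ∧ p ∉ A ∧ p ∉ B ∧ p ∉ C := by
          rintro V' ⟨h, h1, h2, h3⟩ h'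
          obtain rfl := hVu V' h h'
          exact ⟨rfl, nold h1 h2 h3⟩
        rintro X Y ⟨hX, hpX⟩ ⟨hY, hpY⟩
        rw [hQ'] at hX hY
        clear * - hX hY hpX hpY nAB nAC nBC nold'
        rcases hX with hX | rfl | rfl | rfl <;> rcases hY with hY | rfl | rfl | rfl <;> grind
  refine ⟨⟨hP, ?_, ?_, ?_, ?_⟩, hn⟩
  · intro V hV i
    rcases (hQ' V).mp hV with h | rfl | rfl | rfl
    · exact hi V h.1 i
    · exact (mult_le_one_of_not_hasLoop lA i).trans one_le_two
    · exact (mult_le_one_of_not_hasLoop lB i).trans one_le_two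
    · exact (mult_le_one_of_not_hasLoop lC i).trans one_le_two
  · intro V hV i j h1 h2
    rcases (hQ' V).mp hV with h | rfl | rfl | rfl
    · exact hii V h.1 i j h1 h2
    · have := mult_le_one_of_not_hasLoop lA i
      omega
    · have := mult_le_one_of_not_hasLoop lB i
      omega
    · have := mult_le_one_of_not_hasLoop lC i
      omega
  · intro X hX Y hY hXY
    rcases (hQ' X).mp hX with h | h | h | h <;> rcases (hQ' Y).mp hY with h' | h' | h' | h'
    · exact hiii X h.1 Y h'.1 hXY
    · rw [h', Finset.inter_comm]; exact oA X h.1 h.2.1 h.2.2.1 h.2.2.2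
    · rw [h', Finset.inter_comm]; exact oB X h.1 h.2.1 h.2.2.1 h.2.2.2
    · rw [h', Finset.inter_comm]; exact oC X h.1 h.2.1 h.2.2.1 h.2.2.2
    · rw [h]; exact oA Y h'.1 h'.2.1 h'.2.2.1 h'.2.2.2
    · exact absurd (h.trans h'.symm) hXY
    · rw [h, h']; exact oAB
    · rw [h, h']; exact oAC
    · rw [h]; exact oB Y h'.1 h'.2.1 h'.2.2.1 h'.2.2.2
    · rw [h, h', Finset.inter_comm]; exact oAB
    · exact absurd (h.trans h'.symm) hXY
    · rw [h, h']; exact oBC'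
    · rw [h]; exact oC Y h'.1 h'.2.1 h'.2.2.1 h'.2.2.2
    · rw [h, h', Finset.inter_comm]; exact oAC
    · rw [h, h', Finset.inter_comm]; exact oBC'
    · exact absurd (h.trans h'.symm) hXY
  · rw [hn]; omega
end
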